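/- arXiv:2505.19471 — 2 statements merged into one kernel-verified Lean document; each statement's English description precedes it below -/
import Mathlib

section
/- Let p ∈ [1, ∞), let n, k ≥ 1 be integers, let (d_1, …, d_k) be positive integers with d = d_1 + ⋯ + d_k, and let A_c ⊆ M_d(ℂ) be the block-diagonal subalgebra associated with this composition. Let 𝐚 be any (nd)×d matrix obtained by vertically stacking n matrices from A_c. Then the p-operator norm of 𝐚 equals the supremum, over all d×(nd) matrices 𝐛 obtained by horizontally concatenating n matrices from A_c and having p-operator norm at most 1, of the p-operator norm of the d×d matrix 𝐛𝐚; moreover this supremum is attained. (This is the first C*-likeness condition for the row-column module over A_c.) -/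
open scoped ENNReal

/-- The `(p → q)`-operator norm of a complex matrix, i.e. its norm as a linear
operator from `ℓ^p` to `ℓ^q` (finite-dimensional). -/
noncomputable def opNorm (p q : ℝ≥0∞) [Fact (1 ≤ p)] [Fact (1 ≤ q)]
    {ι κ : Type*} [Fintype ι] [Fintype κ] (a : Matrix ι κ ℂ) : ℝ :=
  ‖LinearMap.toContinuousLinearMap
    (((WithLp.linearEquiv q ℂ (ι → ℂ)).symm.toLinearMap.comp
      a.mulVecLin).comp (WithLp.linearEquiv p ℂ (κ → ℂ)).toLinearMap)‖

/-- The block-diagonal matrix with blocks `a j` along the diagonal. -/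
def blockDiag {k : ℕ} (d : Fin k → ℕ) (a : ∀ j, Matrix (Fin (d j)) (Fin (d j)) ℂ) :
    Matrix (Σ j, Fin (d j)) (Σ j, Fin (d j)) ℂ :=
  Matrix.of fun s t =>
    if h : s.1 = t.1 then a s.1 s.2 (Fin.cast (congrArg d h.symm) t.2) else 0

/-- Vertical stack of the `n` block-diagonal matrices `blockDiag d (a i)`. -/
def vStackBD {n k : ℕ} (d : Fin k → ℕ)
    (a : Fin n → ∀ j, Matrix (Fin (d j)) (Fin (d j)) ℂ) :
    Matrix (Fin n × Σ j, Fin (d j)) (Σ j, Fin (d j)) ℂ :=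
  Matrix.of fun x t => blockDiag d (a x.1) x.2 t

/-- Horizontal concatenation of the `n` block-diagonal matrices `blockDiag d (b i)`. -/
def hStackBD {n k : ℕ} (d : Fin k → ℕ)
    (b : Fin n → ∀ j, Matrix (Fin (d j)) (Fin (d j)) ℂ) :
    Matrix (Σ j, Fin (d j)) (Fin n × Σ j, Fin (d j)) ℂ :=
  Matrix.of fun s c => blockDiag d (b c.1) s c.2

section RestrictLabel

variable {p : ℝ≥0∞} {ι J : Type*}

/-- Restriction of a vector to the coordinates with label `j`. -/
noncomputable def restrictLabel (p : ℝ≥0∞) [DecidableEq J] (g : ι → J) (j : J)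
    (x : PiLp p (fun _ : ι => ℂ)) : PiLp p (fun _ : ι => ℂ) :=
  WithLp.toLp p fun i => if g i = j then x i else 0

lemma restrictLabel_apply [DecidableEq J] (g : ι → J) (j : J)
    (x : PiLp p (fun _ : ι => ℂ)) (i : ι) :
    restrictLabel p g j x i = if g i = j then x i else 0 := rfl

lemma apply_eq_sum_single [Fintype ι] [DecidableEq ι] (φ : StrongDual ℂ (PiLp p (fun _ : ι => ℂ)))
    (x : PiLp p (fun _ : ι => ℂ)) :
    φ x = ∑ i, x i * φ (PiLp.single p i 1) := by
  conv_lhs => rw [← (PiLp.basisFun p ℂ ι).sum_repr x]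
  simp [map_sum]

end RestrictLabel

/-- A complex matrix as a continuous linear map `ℓ^p → ℓ^p`. -/
noncomputable def lpOp (p : ℝ≥0∞) [Fact (1 ≤ p)] {ι κ : Type*} [Fintype ι] [Fintype κ]
    (a : Matrix ι κ ℂ) : PiLp p (fun _ : κ => ℂ) →L[ℂ] PiLp p (fun _ : ι => ℂ) :=
  LinearMap.toContinuousLinearMap
    (((WithLp.linearEquiv p ℂ (ι → ℂ)).symm.toLinearMap.comp
      a.mulVecLin).comp (WithLp.linearEquiv p ℂ (κ → ℂ)).toLinearMap)

section LpOp

variable (p : ℝ≥0∞) [Fact (1 ≤ p)] {ι κ μ J : Type*} [Fintype ι] [Fintype κ] [Fintype μ]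

lemma opNorm_eq_norm_lpOp (a : Matrix ι κ ℂ) : opNorm p p a = ‖lpOp p a‖ := rfl

lemma lpOp_apply (a : Matrix ι κ ℂ) (x : PiLp p (fun _ : κ => ℂ)) (i : ι) :
    lpOp p a x i = ∑ t, a i t * x t := rfl

lemma lpOp_mul (b : Matrix μ ι ℂ) (a : Matrix ι κ ℂ) :
    lpOp p (b * a) = (lpOp p b).comp (lpOp p a) := by
  ext x i
  exact congrFun (Matrix.mulVec_mulVec (WithLp.ofLp x) b a).symm i

variable {p}

lemma norm_rpow_eq_sum (hp : p ≠ ∞) (x : PiLp p (fun _ : ι => ℂ)) :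
    ‖x‖ ^ p.toReal = ∑ i, ‖x i‖ ^ p.toReal := by
  have h0 : 0 < p.toReal :=
    ENNReal.toReal_pos (zero_lt_one.trans_le Fact.out).ne' hp
  rw [PiLp.norm_eq_sum h0, ← Real.rpow_mul (by positivity), one_div_mul_cancel h0.ne',
    Real.rpow_one]

lemma norm_rpow_eq_sum_restrictLabel [Fintype J] [DecidableEq J] (hp : p ≠ ∞) (g : ι → J)
    (x : PiLp p (fun _ : ι => ℂ)) :
    ‖x‖ ^ p.toReal = ∑ j, ‖restrictLabel p g j x‖ ^ p.toReal := by
  have h0 : 0 < p.toReal :=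
    ENNReal.toReal_pos (zero_lt_one.trans_le Fact.out).ne' hp
  simp_rw [norm_rpow_eq_sum hp, restrictLabel_apply]
  rw [Finset.sum_comm]
  refine Finset.sum_congr rfl fun i _ => ?_
  rw [Finset.sum_eq_single (g i)]
  · simp
  · intro j _ hj
    simp [hj.symm, h0.ne']
  · simp

lemma norm_restrictLabel_le [Fintype J] [DecidableEq J] (hp : p ≠ ∞) (g : ι → J) (j : J)
    (x : PiLp p (fun _ : ι => ℂ)) : ‖restrictLabel p g j x‖ ≤ ‖x‖ := by
  have h0 : 0 < p.toReal :=
    ENNReal.toReal_pos (zero_lt_one.trans_le Fact.out).ne' hp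
  rw [← Real.rpow_le_rpow_iff (norm_nonneg _) (norm_nonneg _) h0,
    norm_rpow_eq_sum_restrictLabel hp g x]
  exact Finset.single_le_sum (f := fun j => ‖restrictLabel p g j x‖ ^ p.toReal)
    (fun _ _ => by positivity) (Finset.mem_univ j)

lemma lpOp_restrictLabel [DecidableEq J] {g : ι → J} {g' : κ → J} {a : Matrix ι κ ℂ}
    (ha : ∀ i t, g i ≠ g' t → a i t = 0) (j : J) (x : PiLp p (fun _ : κ => ℂ)) :
    lpOp p a (restrictLabel p g' j x) = restrictLabel p g j (lpOp p a x) := by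
  ext i
  rw [restrictLabel_apply, lpOp_apply, lpOp_apply]
  simp_rw [restrictLabel_apply]
  split_ifs with hi
  · refine Finset.sum_congr rfl fun t _ => ?_
    split_ifs with ht
    · rfl
    · rw [ha i t (by rw [hi]; exact Ne.symm ht)]; simp
  · refine Finset.sum_eq_zero fun t _ => ?_
    split_ifs with ht
    · rw [ha i t (by rw [ht]; exact hi)]; simp
    · simp

/-- A continuous linear map on a finite-dimensional space attains its norm on the unit ball. -/
lemma exists_norm_le_one_norm_apply_eq {E F : Type*} [NormedAddCommGroup E] [NormedSpace ℂ E]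
    [FiniteDimensional ℂ E] [NormedAddCommGroup F] [NormedSpace ℂ F] (T : E →L[ℂ] F) :
    ∃ x, ‖x‖ ≤ 1 ∧ ‖T x‖ = ‖T‖ := by
  have := FiniteDimensional.proper ℂ E
  obtain ⟨x, hx, hmax⟩ := (isCompact_closedBall (0 : E) 1).exists_isMaxOn
    ⟨0, by simp⟩ (f := fun x => ‖T x‖) (by fun_prop)
  rw [mem_closedBall_zero_iff] at hx
  refine ⟨x, hx, le_antisymm (T.unit_le_opNorm x hx) ?_⟩
  refine ContinuousLinearMap.opNorm_le_of_unit_norm (norm_nonneg _) fun y hy => ?_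
  exact hmax (by simp [hy])

/-- A nonzero matrix that respects a labelling of its rows and columns attains its norm at a
unit vector supported on a single label. -/
lemma exists_restrictLabel_norm_lpOp_eq [Fintype J] [DecidableEq J] (hp : p ≠ ∞)
    {g : ι → J} {g' : κ → J} {a : Matrix ι κ ℂ} (ha : ∀ i t, g i ≠ g' t → a i t = 0)
    (h : ‖lpOp p a‖ ≠ 0) :
    ∃ (j : J) (u : PiLp p (fun _ : κ => ℂ)), (∀ t, g' t ≠ j → u t = 0) ∧ ‖u‖ = 1 ∧
      ‖lpOp p a u‖ = ‖lpOp p a‖ := by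
  have h0 : 0 < p.toReal :=
    ENNReal.toReal_pos (zero_lt_one.trans_le Fact.out).ne' hp
  obtain ⟨x, hx, hTx⟩ := exists_norm_le_one_norm_apply_eq (lpOp p a)
  have hle : ∀ j ∈ Finset.univ, ‖lpOp p a (restrictLabel p g' j x)‖ ^ p.toReal ≤
      (‖lpOp p a‖ * ‖restrictLabel p g' j x‖) ^ p.toReal := fun j _ =>
    Real.rpow_le_rpow (norm_nonneg _) ((lpOp p a).le_opNorm _) h0.le
  have hsum : ∑ j, ‖lpOp p a (restrictLabel p g' j x)‖ ^ p.toReal =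
      ∑ j, (‖lpOp p a‖ * ‖restrictLabel p g' j x‖) ^ p.toReal := by
    refine le_antisymm (Finset.sum_le_sum hle) ?_
    simp_rw [lpOp_restrictLabel ha, Real.mul_rpow (norm_nonneg _) (norm_nonneg _)]
    rw [← norm_rpow_eq_sum_restrictLabel hp, ← Finset.mul_sum,
      ← norm_rpow_eq_sum_restrictLabel hp, hTx]
    exact mul_le_of_le_one_right (by positivity) (Real.rpow_le_one (norm_nonneg _) hx h0.le)
  have heq := (Finset.sum_eq_sum_iff_of_le hle).1 hsum
  obtain ⟨j, hj⟩ : ∃ j, ‖restrictLabel p g' j x‖ ≠ 0 := by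
    by_contra! hall
    have hx0 : ‖x‖ ^ p.toReal = 0 := by
      rw [norm_rpow_eq_sum_restrictLabel hp g']
      simp [hall, h0.ne']
    rw [Real.rpow_eq_zero (norm_nonneg _) h0.ne', norm_eq_zero] at hx0
    rw [hx0, map_zero, norm_zero] at hTx
    exact h hTx.symm
  have hj' : ‖lpOp p a (restrictLabel p g' j x)‖ = ‖lpOp p a‖ * ‖restrictLabel p g' j x‖ :=
    (Real.rpow_left_inj (norm_nonneg _) (by positivity) h0.ne').1 (heq j (Finset.mem_univ j))
  refine ⟨j, (‖restrictLabel p g' j x‖⁻¹ : ℂ) • restrictLabel p g' j x, fun t ht => ?_, ?_, ?_⟩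
  · simp [restrictLabel_apply, ht]
  · rw [norm_smul, norm_inv, Complex.norm_real, norm_norm, inv_mul_cancel₀ hj]
  · rw [map_smul, norm_smul, norm_inv, Complex.norm_real, norm_norm, hj']
    field_simp

end LpOp

section BlockDiag

variable {n k : ℕ} {d : Fin k → ℕ}

lemma vStackBD_eq_zero (a : Fin n → ∀ j, Matrix (Fin (d j)) (Fin (d j)) ℂ)
    (x : Fin n × Σ j, Fin (d j)) (t : Σ j, Fin (d j)) (h : x.2.1 ≠ t.1) :
    vStackBD d a x t = 0 := by
  simp [vStackBD, blockDiag, h]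

/-- A rank-one matrix `u ⊗ f` with `u` supported on the block `j`, compressed to that block, is
a row of block-diagonal matrices. -/
lemma exists_hStackBD_eq (j : Fin k) {u : (Σ j, Fin (d j)) → ℂ} (hu : ∀ s, s.1 ≠ j → u s = 0)
    (f : (Fin n × Σ j, Fin (d j)) → ℂ) :
    ∃ b : Fin n → ∀ j, Matrix (Fin (d j)) (Fin (d j)) ℂ,
      ∀ s c, hStackBD d b s c = u s * if c.2.1 = j then f c else 0 := by
  refine ⟨fun i j' => Matrix.of fun s t => if j' = j then u ⟨j', s⟩ * f (i, ⟨j', t⟩) else 0, ?_⟩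
  rintro ⟨j₁, s⟩ ⟨i, j₂, t⟩
  by_cases h : j₁ = j₂
  · subst h
    simp [hStackBD, blockDiag]
  · by_cases h₁ : j₁ = j
    · subst h₁
      simp [hStackBD, blockDiag, h, Ne.symm h]
    · simp [hStackBD, blockDiag, h, hu ⟨j₁, s⟩ h₁]

end BlockDiag

theorem stmt_10 (p : ℝ≥0∞) [Fact (1 ≤ p)] (hp : p ≠ ∞)
    (n k : ℕ) (hn : 0 < n) (hk : 0 < k)
    (d : Fin k → ℕ) (hd : ∀ j, 0 < d j)
    (a : Fin n → ∀ j, Matrix (Fin (d j)) (Fin (d j)) ℂ) :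
    IsGreatest
      {r : ℝ | ∃ b : Fin n → ∀ j, Matrix (Fin (d j)) (Fin (d j)) ℂ,
        opNorm p p (hStackBD d b) ≤ 1 ∧
        r = opNorm p p (hStackBD d b * vStackBD d a)}
      (opNorm p p (vStackBD d a)) := by
  classical
  simp only [opNorm_eq_norm_lpOp]
  constructor
  · by_cases h : ‖lpOp p (vStackBD d a)‖ = 0
    · have h0 : lpOp p (hStackBD d (0 : Fin n → ∀ j, Matrix (Fin (d j)) (Fin (d j)) ℂ)) = 0 := by
        ext x s
        simp [lpOp_apply, hStackBD, blockDiag]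
      refine ⟨0, ?_, ?_⟩
      · simp [h0]
      · simp [lpOp_mul, h0, h]
    · obtain ⟨j, u, hu, hu1, hTu⟩ := exists_restrictLabel_norm_lpOp_eq hp
        (g := fun x => x.2.1) (g' := Sigma.fst) (vStackBD_eq_zero a) h
      obtain ⟨φ, hφ, hφu⟩ := exists_dual_vector ℂ (lpOp p (vStackBD d a) u)
        (by rwa [hTu])
      obtain ⟨b, hb⟩ := exists_hStackBD_eq j hu fun c => φ (PiLp.single p c 1)
      have hbx : ∀ x, lpOp p (hStackBD d b) x =
          φ (restrictLabel p (fun x => x.2.1) j x) • u := by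
        intro x
        ext s
        rw [lpOp_apply, PiLp.smul_apply, apply_eq_sum_single, smul_eq_mul, Finset.sum_mul]
        refine Finset.sum_congr rfl fun c _ => ?_
        rw [hb, restrictLabel_apply]
        split_ifs <;> ring
      have hb1 : ‖lpOp p (hStackBD d b)‖ ≤ 1 := by
        refine ContinuousLinearMap.opNorm_le_bound _ zero_le_one fun x => ?_
        rw [hbx, norm_smul, hu1, mul_one]
        refine (φ.le_opNorm _).trans ?_
        rw [hφ]
        gcongr
        exact norm_restrictLabel_le hp _ j x
      refine ⟨b, hb1, le_antisymm ?_ ?_⟩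
      · have hur : restrictLabel p Sigma.fst j u = u := by
          ext t
          rw [restrictLabel_apply]
          split_ifs with ht
          · rfl
          · exact (hu t ht).symm
        have key : lpOp p (hStackBD d b * vStackBD d a) u =
            (‖lpOp p (vStackBD d a)‖ : ℂ) • u := by
          rw [lpOp_mul, ContinuousLinearMap.comp_apply, hbx,
            ← lpOp_restrictLabel (g' := Sigma.fst) (vStackBD_eq_zero a), hur, hφu, hTu]
          rfl
        have := (lpOp p (hStackBD d b * vStackBD d a)).unit_le_opNorm u hu1.le
        rwa [key, norm_smul, hu1, mul_one, Complex.norm_real, norm_norm] at this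
      · rw [lpOp_mul]
        exact (ContinuousLinearMap.opNorm_comp_le _ _).trans
          (mul_le_of_le_one_left (norm_nonneg _) hb1)
  · rintro r ⟨b, hb, rfl⟩
    rw [lpOp_mul]
    exact (ContinuousLinearMap.opNorm_comp_le _ _).trans
      (mul_le_of_le_one_left (norm_nonneg _) hb)
end

section
/- Let p ∈ [1, ∞), let n, k ≥ 1 be integers, let (d_1, …, d_k) be positive integers with d = d_1 + ⋯ + d_k, and let A_c ⊆ M_d(ℂ) be the block-diagonal subalgebra associated with this composition. Let 𝐛 be any d×(nd) matrix obtained by horizontally concatenating n matrices from A_c. Then the p-operator norm of 𝐛 equals the supremum, over all (nd)×d matrices 𝐚 obtained by vertically stacking n matrices from A_c and having p-operator norm at most 1, of the p-operator norm of the d×d matrix 𝐛𝐚; moreover this supremum is attained. (This is the second C*-likeness condition for the row-column module over A_c.) -/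
open scoped ENNReal

section OpNorm

variable {ι κ μ : Type*} [Fintype ι] [Fintype κ] [Fintype μ] (p : ℝ≥0∞) [Fact (1 ≤ p)]

theorem norm_toLp_mulVec_le_opNorm (a : Matrix ι κ ℂ) (x : κ → ℂ) :
    ‖WithLp.toLp p (a.mulVec x)‖ ≤ opNorm p p a * ‖WithLp.toLp p x‖ :=
  ContinuousLinearMap.le_opNorm (LinearMap.toContinuousLinearMap
    (((WithLp.linearEquiv p ℂ (ι → ℂ)).symm.toLinearMap.comp
      a.mulVecLin).comp (WithLp.linearEquiv p ℂ (κ → ℂ)).toLinearMap)) (WithLp.toLp p x)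

theorem opNorm_le_bound (a : Matrix ι κ ℂ) {C : ℝ} (hC : 0 ≤ C)
    (h : ∀ x : κ → ℂ, ‖WithLp.toLp p (a.mulVec x)‖ ≤ C * ‖WithLp.toLp p x‖) :
    opNorm p p a ≤ C :=
  ContinuousLinearMap.opNorm_le_bound _ hC fun x => h (WithLp.ofLp x)

theorem opNorm_nonneg (a : Matrix ι κ ℂ) : 0 ≤ opNorm p p a :=
  norm_nonneg _

theorem opNorm_mul_le (a : Matrix ι κ ℂ) (b : Matrix κ μ ℂ) :
    opNorm p p (a * b) ≤ opNorm p p a * opNorm p p b := by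
  refine opNorm_le_bound p _ (mul_nonneg (opNorm_nonneg p a) (opNorm_nonneg p b)) fun x => ?_
  rw [← Matrix.mulVec_mulVec, mul_assoc]
  exact (norm_toLp_mulVec_le_opNorm p a _).trans
    (mul_le_mul_of_nonneg_left (norm_toLp_mulVec_le_opNorm p b x) (opNorm_nonneg p a))

/-- In finite dimensions the operator norm is attained on the closed unit ball. -/
theorem exists_norm_toLp_mulVec_eq_opNorm (a : Matrix ι κ ℂ) :
    ∃ x : κ → ℂ, ‖WithLp.toLp p x‖ ≤ 1 ∧ opNorm p p a = ‖WithLp.toLp p (a.mulVec x)‖ := by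
  set T := LinearMap.toContinuousLinearMap
    (((WithLp.linearEquiv p ℂ (ι → ℂ)).symm.toLinearMap.comp
      a.mulVecLin).comp (WithLp.linearEquiv p ℂ (κ → ℂ)).toLinearMap)
  have : ProperSpace (WithLp p (κ → ℂ)) := FiniteDimensional.proper ℂ _
  obtain ⟨x, hx, hmax⟩ := (isCompact_closedBall (0 : WithLp p (κ → ℂ)) 1).exists_sSup_image_eq
    ⟨0, by simp⟩ (f := fun x => ‖T x‖) T.continuous.norm.continuousOn
  refine ⟨WithLp.ofLp x, by simpa using hx, ?_⟩
  rw [T.sSup_unitClosedBall_eq_norm] at hmax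
  exact hmax

end OpNorm

theorem vStackBD_mulVec {n k : ℕ} (d : Fin k → ℕ)
    (a : Fin n → ∀ j, Matrix (Fin (d j)) (Fin (d j)) ℂ) (x : (Σ j, Fin (d j)) → ℂ)
    (i : Fin n) (j : Fin k) (s : Fin (d j)) :
    (vStackBD d a).mulVec x (i, ⟨j, s⟩) = ∑ t, a i j s t * x ⟨j, t⟩ := by
  simp only [Matrix.mulVec, dotProduct, vStackBD, blockDiag, Matrix.of_apply]
  rw [Fintype.sum_sigma, Finset.sum_eq_single j]
  · simp
  · intro j' _ hj
    simp [hj.symm]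
  · simp

/-- Every vector `ξ` is the image of a vector of the same norm under a contractive column of
block-diagonal matrices. -/
theorem exists_vStackBD_mulVec_eq (p : ℝ≥0∞) [Fact (1 ≤ p)] (hp : p ≠ ∞) {n k : ℕ}
    (d : Fin k → ℕ) (hd : ∀ j, 0 < d j) (ξ : (Fin n × Σ j, Fin (d j)) → ℂ) :
    ∃ (a : Fin n → ∀ j, Matrix (Fin (d j)) (Fin (d j)) ℂ) (η : (Σ j, Fin (d j)) → ℂ),
      opNorm p p (vStackBD d a) ≤ 1 ∧ (vStackBD d a).mulVec η = ξ ∧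
        ‖WithLp.toLp p η‖ = ‖WithLp.toLp p ξ‖ := by
  have hr : 0 < p.toReal :=
    ENNReal.toReal_pos (zero_lt_one.trans_le (Fact.out : 1 ≤ p)).ne' hp
  set r := p.toReal
  let o : ∀ j, Fin (d j) := fun j => ⟨0, hd j⟩
  let w : Fin k → ℝ := fun j => ∑ i, ∑ s, ‖ξ (i, ⟨j, s⟩)‖ ^ r
  have hw : ∀ j, 0 ≤ w j := fun j => by positivity
  let c : Fin k → ℝ := fun j => w j ^ (1 / r)
  have hc : ∀ j, 0 ≤ c j := fun j => Real.rpow_nonneg (hw j) _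
  have hcr : ∀ j, c j ^ r = w j := fun j => by
    rw [← Real.rpow_mul (hw j), one_div_mul_cancel hr.ne', Real.rpow_one]
  have hsum : ∀ f : (Fin n × Σ j, Fin (d j)) → ℝ,
      ∑ x, f x = ∑ j, ∑ i, ∑ s, f (i, ⟨j, s⟩) := fun f => by
    rw [Fintype.sum_prod_type, Finset.sum_comm, Fintype.sum_sigma]
    exact Finset.sum_congr rfl fun j _ => Finset.sum_comm
  let a : Fin n → ∀ j, Matrix (Fin (d j)) (Fin (d j)) ℂ := fun i j =>
    Matrix.of fun s t => if t = o j then ξ (i, ⟨j, s⟩) / c j else 0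
  have ha : ∀ x i j s, (vStackBD d a).mulVec x (i, ⟨j, s⟩) =
      ξ (i, ⟨j, s⟩) / c j * x ⟨j, o j⟩ := fun x i j s => by
    simp [vStackBD_mulVec, a]
  refine ⟨a, fun t => if t.2 = o t.1 then (c t.1 : ℂ) else 0, ?_, ?_, ?_⟩
  · refine opNorm_le_bound p _ zero_le_one fun x => ?_
    rw [one_mul, PiLp.norm_eq_sum hr, PiLp.norm_eq_sum hr]
    refine Real.rpow_le_rpow (by positivity) ?_ (by positivity)
    rw [hsum, Fintype.sum_sigma]
    refine Finset.sum_le_sum fun j _ => ?_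
    have hj : ∑ i, ∑ s, ‖(vStackBD d a).mulVec x (i, ⟨j, s⟩)‖ ^ r =
        w j / w j * ‖x ⟨j, o j⟩‖ ^ r := by
      have h1 : ∀ i s, ‖(vStackBD d a).mulVec x (i, ⟨j, s⟩)‖ ^ r =
          ‖ξ (i, ⟨j, s⟩)‖ ^ r * (‖x ⟨j, o j⟩‖ ^ r / w j) := fun i s => by
        rw [ha, norm_mul, norm_div, Complex.norm_of_nonneg (hc j),
          Real.mul_rpow (by have := hc j; positivity) (norm_nonneg _),
          Real.div_rpow (norm_nonneg _) (hc j), hcr]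
        ring
      simp only [h1, ← Finset.sum_mul]
      change w j * _ = _
      ring
    calc _ = w j / w j * ‖x ⟨j, o j⟩‖ ^ r := hj
      _ ≤ ‖x ⟨j, o j⟩‖ ^ r :=
        mul_le_of_le_one_left (by positivity) (div_self_le_one _)
      _ ≤ _ := Finset.single_le_sum (f := fun t => ‖x ⟨j, t⟩‖ ^ r)
        (fun _ _ => by positivity) (Finset.mem_univ (o j))
  · funext ⟨i, j, s⟩
    rw [ha]
    by_cases h : c j = 0
    · have hwj : w j = 0 := by rw [← hcr, h, Real.zero_rpow hr.ne']
      have h1 := (Finset.sum_eq_zero_iff_of_nonneg fun i _ => by positivity).1 hwj i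
        (Finset.mem_univ _)
      have h2 := (Finset.sum_eq_zero_iff_of_nonneg fun s _ => by positivity).1 h1 s
        (Finset.mem_univ _)
      rw [Real.rpow_eq_zero (norm_nonneg _) hr.ne', norm_eq_zero] at h2
      simp [h2]
    · have : (c j : ℂ) ≠ 0 := by exact_mod_cast h
      simp [this]
  · rw [PiLp.norm_eq_sum hr, PiLp.norm_eq_sum hr, hsum, Fintype.sum_sigma]
    congr 1
    refine Finset.sum_congr rfl fun j _ => ?_
    rw [Finset.sum_eq_single (o j)]
    · simp only [if_true]
      rw [Complex.norm_of_nonneg (hc j)]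
      exact hcr j
    · intro t _ ht
      simpa [ht] using Real.zero_rpow hr.ne'
    · simp

theorem stmt_11 (p : ℝ≥0∞) [Fact (1 ≤ p)] (hp : p ≠ ∞)
    (n k : ℕ) (hn : 0 < n) (hk : 0 < k)
    (d : Fin k → ℕ) (hd : ∀ j, 0 < d j)
    (b : Fin n → ∀ j, Matrix (Fin (d j)) (Fin (d j)) ℂ) :
    IsGreatest
      {r : ℝ | ∃ a : Fin n → ∀ j, Matrix (Fin (d j)) (Fin (d j)) ℂ,
        opNorm p p (vStackBD d a) ≤ 1 ∧
        r = opNorm p p (hStackBD d b * vStackBD d a)}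
      (opNorm p p (hStackBD d b)) := by
  constructor
  · obtain ⟨ξ, hξ, hmax⟩ := exists_norm_toLp_mulVec_eq_opNorm p (hStackBD d b)
    obtain ⟨a, η, ha, hη, hnorm⟩ := exists_vStackBD_mulVec_eq p hp d hd ξ
    refine ⟨a, ha, le_antisymm ?_ ?_⟩
    · rw [hmax, ← hη, Matrix.mulVec_mulVec]
      exact (norm_toLp_mulVec_le_opNorm p _ η).trans
        (mul_le_of_le_one_right (opNorm_nonneg p _) (hnorm.trans_le hξ))
    · exact (opNorm_mul_le p _ _).trans (mul_le_of_le_one_right (opNorm_nonneg p _) ha)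
  · rintro _ ⟨a, ha, rfl⟩
    exact (opNorm_mul_le p _ _).trans (mul_le_of_le_one_right (opNorm_nonneg p _) ha)
end
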